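/- arXiv:2004.13378 — 3 statements merged into one kernel-verified Lean document; each statement's English description precedes it below -/
import Mathlib

section
/- Let r⊕ > 0 and rmin > 0 be real numbers, let ρ = r⊕ + rmin, let S be the sphere of radius ρ centered at the origin in EuclideanSpace ℝ (Fin 3), let u be a fixed point with ‖u‖ = r⊕, and let μ be the uniform probability measure on S (the 2-dimensional Hausdorff measure restricted to S, normalized to total mass 1). Then for every real r with rmin ≤ r ≤ 2·r⊕ + rmin, μ {x ∈ S : ‖x − u‖ ≤ r} = (r² − rmin²) / (4·r⊕·(r⊕ + rmin)); moreover this measure equals 0 for r < rmin and equals 1 for r > 2·r⊕ + rmin. -/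
open MeasureTheory


noncomputable def psiMap (p : ℝ × (EuclideanSpace ℝ (Fin 2))) : (EuclideanSpace ℝ (Fin 3)) :=
  WithLp.toLp 2 ((MeasurableEquiv.piFinSuccAbove (fun _ : Fin 3 => ℝ) 0).symm (p.1, WithLp.ofLp p.2))

lemma psiMap_mp : MeasurePreserving psiMap (volume : Measure (ℝ × (EuclideanSpace ℝ (Fin 2)))) (volume : Measure (EuclideanSpace ℝ (Fin 3))) := by
  have h1 := PiLp.volume_preserving_toLp (Fin 3)
  have h2 := (volume_preserving_piFinSuccAbove (fun _ : Fin 3 => ℝ) 0).symm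
  have h3 : MeasurePreserving (Prod.map id (WithLp.ofLp : (EuclideanSpace ℝ (Fin 2)) → (Fin 2 → ℝ)))
      (volume : Measure (ℝ × (EuclideanSpace ℝ (Fin 2)))) (volume : Measure (ℝ × (Fin 2 → ℝ))) :=
    (MeasurePreserving.id volume).prod (PiLp.volume_preserving_ofLp (Fin 2))
  exact h1.comp (h2.comp h3)

lemma psiMap_zero (t : ℝ) (z : (EuclideanSpace ℝ (Fin 2))) : psiMap (t, z) 0 = t := by
  simp [psiMap]

lemma psiMap_norm (t : ℝ) (z : (EuclideanSpace ℝ (Fin 2))) : ‖psiMap (t, z)‖ ^ 2 = t ^ 2 + ‖z‖ ^ 2 := by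
  simp [EuclideanSpace.norm_sq_eq, psiMap, Fin.sum_univ_succ, MeasurableEquiv.piFinSuccAbove]

lemma disc_vol (q : ℝ) (hq : 0 ≤ q) (B : Set (EuclideanSpace ℝ (Fin 2))) (h1 : ∀ z : (EuclideanSpace ℝ (Fin 2)), ‖z‖ ^ 2 < q → z ∈ B)
    (h2 : ∀ z ∈ B, ‖z‖ ^ 2 ≤ q) : volume B = ENNReal.ofReal (Real.pi * q) := by
  have e : ENNReal.ofReal (√q) ^ 2 * ENNReal.ofReal Real.pi = ENNReal.ofReal (Real.pi * q) := by
    rw [← ENNReal.ofReal_pow (Real.sqrt_nonneg _), Real.sq_sqrt hq, ← ENNReal.ofReal_mul hq, mul_comm]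
  apply le_antisymm
  · rw [← e, ← EuclideanSpace.volume_closedBall_fin_two 0]
    apply measure_mono
    intro z hz
    simpa using Real.le_sqrt_of_sq_le (h2 z hz)
  · rw [← e, ← EuclideanSpace.volume_ball_fin_two 0]
    apply measure_mono
    intro z hz
    have : ‖z‖ < √q := by simpa using hz
    exact h1 z ((Real.lt_sqrt (norm_nonneg _)).1 this)

lemma sector_vol (c : ℝ) (h0 : 0 ≤ c) (hc1 : c ≤ 1) (T : Set (EuclideanSpace ℝ (Fin 3))) (hT : MeasurableSet T)
    (h1 : ∀ y : (EuclideanSpace ℝ (Fin 3)), ‖y‖ < 1 → c * ‖y‖ < y 0 → y ∈ T)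
    (h2 : ∀ y ∈ T, ‖y‖ ≤ 1 ∧ c * ‖y‖ ≤ y 0) :
    volume T = ENNReal.ofReal (2 * Real.pi / 3 * (1 - c)) := by
  rw [← psiMap_mp.measure_preimage hT.nullMeasurableSet, Measure.volume_eq_prod,
    Measure.prod_apply (psiMap_mp.measurable hT)]
  have key : ∀ᵐ t : ℝ, volume (Prod.mk t ⁻¹' (psiMap ⁻¹' T)) =
      (Set.Ioc 0 c).indicator (fun t => ENNReal.ofReal (Real.pi * (t ^ 2 * (1 / c ^ 2 - 1)))) t +
      (Set.Ioc c 1).indicator (fun t => ENNReal.ofReal (Real.pi * (1 - t ^ 2))) t := by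
    have : ∀ᵐ t : ℝ, t ≠ 0 := by simp [ae_iff]
    filter_upwards [this] with t ht
    have H : ∀ z : (EuclideanSpace ℝ (Fin 2)), z ∈ Prod.mk t ⁻¹' (psiMap ⁻¹' T) → t ^ 2 + ‖z‖ ^ 2 ≤ 1 ∧ 0 < t ∧
        c ^ 2 * (t ^ 2 + ‖z‖ ^ 2) ≤ t ^ 2 := by
      intro z hz
      obtain ⟨a, b⟩ := h2 _ hz
      rw [psiMap_zero] at b
      rw [← psiMap_norm]
      have n0 := norm_nonneg (psiMap (t, z))
      have : 0 ≤ c * ‖psiMap (t, z)‖ := by positivity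
      refine ⟨by nlinarith, lt_of_le_of_ne (by linarith) (Ne.symm ht), ?_⟩
      rw [← mul_pow]
      exact pow_le_pow_left₀ this b 2
    have H' : ∀ z : (EuclideanSpace ℝ (Fin 2)), t ^ 2 + ‖z‖ ^ 2 < 1 → 0 < t →
        c ^ 2 * (t ^ 2 + ‖z‖ ^ 2) < t ^ 2 → z ∈ Prod.mk t ⁻¹' (psiMap ⁻¹' T) := by
      intro z a b d
      rw [← psiMap_norm] at a d
      apply h1
      · have n0 := norm_nonneg (psiMap (t, z))
        nlinarith
      · rw [psiMap_zero]
        rw [← mul_pow] at d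
        exact lt_of_pow_lt_pow_left₀ 2 b.le d
    rcases le_or_gt t 0 with ht0 | ht0
    · rw [Set.indicator_of_notMem (by simp; intro h; linarith),
        Set.indicator_of_notMem (by simp; intro h; linarith), add_zero]
      have : Prod.mk t ⁻¹' (psiMap ⁻¹' T) = ∅ := by
        ext z
        simp only [Set.mem_empty_iff_false, iff_false]
        intro hz
        linarith [(H z hz).2.1]
      rw [this]; simp
    rcases le_or_gt t c with htc | htc
    · rw [Set.indicator_of_mem (by exact ⟨ht0, htc⟩),
        Set.indicator_of_notMem (by simp; intro h; linarith), add_zero]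
      have hc : 0 < c := by linarith
      have hcc : t ^ 2 * (1 / c ^ 2 - 1) = (t ^ 2 - c ^ 2 * t ^ 2) / c ^ 2 := by
        field_simp
      have hc2 : 0 < c ^ 2 := by positivity
      have c21 : c ^ 2 ≤ 1 := by nlinarith
      have t2 : t ^ 2 ≤ c ^ 2 := by nlinarith
      rw [hcc]
      apply disc_vol
      · apply div_nonneg _ hc2.le
        nlinarith [sq_nonneg t]
      · intro z hz
        rw [lt_div_iff₀ hc2] at hz
        apply H' z _ ht0 (by linarith)
        nlinarith
      · intro z hz
        rw [le_div_iff₀ hc2]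
        linarith [(H z hz).2.2]
    rcases le_or_gt t 1 with ht1 | ht1
    · rw [Set.indicator_of_notMem (by simp; intro h; linarith),
        Set.indicator_of_mem (by exact ⟨htc, ht1⟩), zero_add]
      apply disc_vol
      · nlinarith
      · intro z hz
        have : c ^ 2 < t ^ 2 := by nlinarith
        apply H' z (by linarith) ht0
        nlinarith [sq_nonneg c, sq_nonneg ‖z‖]
      · intro z hz
        linarith [(H z hz).1]
    · rw [Set.indicator_of_notMem (by simp; intro h; linarith),
        Set.indicator_of_notMem (by simp; intro h; linarith), add_zero]
      have : Prod.mk t ⁻¹' (psiMap ⁻¹' T) = ∅ := by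
        ext z
        simp only [Set.mem_empty_iff_false, iff_false]
        intro hz
        nlinarith [(H z hz).1, sq_nonneg ‖z‖]
      rw [this]; simp
  rw [lintegral_congr_ae key, lintegral_add_left (by
    apply Measurable.indicator _ measurableSet_Ioc
    fun_prop), lintegral_indicator measurableSet_Ioc, lintegral_indicator measurableSet_Ioc,
    ← ofReal_integral_eq_lintegral_ofReal, ← ofReal_integral_eq_lintegral_ofReal,
    ← intervalIntegral.integral_of_le h0, ← intervalIntegral.integral_of_le hc1,
    ← ENNReal.ofReal_add]
  · congr 1
    simp only [intervalIntegral.integral_const_mul, intervalIntegral.integral_mul_const]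
    rw [intervalIntegral.integral_sub (by simp) (by apply Continuous.intervalIntegrable; fun_prop)]
    simp only [integral_pow, intervalIntegral.integral_const]
    rcases h0.eq_or_lt with rfl | h0
    · norm_num; ring
    · simp; field_simp; ring
  · apply intervalIntegral.integral_nonneg h0
    intro t ht
    rcases h0.eq_or_lt with rfl | h0
    · have : t = 0 := le_antisymm ht.2 ht.1
      simp [this]
    · have : 1 ≤ 1 / c ^ 2 := by
        rw [le_div_iff₀ (by positivity)]; nlinarith
      have : 0 ≤ 1 / c ^ 2 - 1 := by linarith
      positivity
  · apply intervalIntegral.integral_nonneg hc1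
    intro t ht
    have : 0 ≤ 1 - t ^ 2 := by nlinarith [ht.1, ht.2]
    positivity
  · apply Continuous.integrableOn_Ioc; fun_prop
  · filter_upwards [ae_restrict_mem measurableSet_Ioc] with t ht
    have : 0 ≤ 1 - t ^ 2 := by nlinarith [ht.1, ht.2]
    show (0:ℝ) ≤ _
    positivity
  · apply Continuous.integrableOn_Ioc; fun_prop
  · filter_upwards [ae_restrict_mem measurableSet_Ioc] with t ht
    have h0 : 0 < c := lt_of_lt_of_le ht.1 ht.2
    have : 1 ≤ 1 / c ^ 2 := by
      rw [le_div_iff₀ (by positivity)]; nlinarith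
    have : 0 ≤ 1 / c ^ 2 - 1 := by linarith
    show (0:ℝ) ≤ _
    positivity

/-- Volume of the spherical sector, all `c ∈ [-1,1]`. -/
lemma sector_vol' (c : ℝ) (h0 : -1 ≤ c) (hc1 : c ≤ 1) :
    volume (Metric.closedBall (0 : (EuclideanSpace ℝ (Fin 3))) 1 ∩ {y | c * ‖y‖ ≤ y 0})
      = ENNReal.ofReal (2 * Real.pi / 3 * (1 - c)) := by
  have hm : MeasurableSet {y : (EuclideanSpace ℝ (Fin 3)) | c * ‖y‖ ≤ y 0} :=
    (isClosed_le (by fun_prop) (by fun_prop)).measurableSet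
  rcases le_or_gt 0 c with h | h
  · apply sector_vol c h hc1 _ (measurableSet_closedBall.inter hm)
    · intro y a b
      exact ⟨by simpa using a.le, b.le⟩
    · rintro y ⟨a, b⟩
      exact ⟨by simpa using a, b⟩
  · have e := measure_inter_add_sdiff (μ := volume) (Metric.closedBall (0 : (EuclideanSpace ℝ (Fin 3))) 1) hm
    have e2 : volume (Metric.closedBall (0 : (EuclideanSpace ℝ (Fin 3))) 1 \ {y | c * ‖y‖ ≤ y 0})
        = ENNReal.ofReal (2 * Real.pi / 3 * (1 - -c)) := by
      rw [← (LinearIsometryEquiv.neg ℝ (E := (EuclideanSpace ℝ (Fin 3)))).measurePreserving.measure_preimage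
        (measurableSet_closedBall.diff hm).nullMeasurableSet]
      apply sector_vol (-c) (by linarith) (by linarith) _
        ((LinearIsometryEquiv.neg ℝ (E := (EuclideanSpace ℝ (Fin 3)))).measurePreserving.measurable
          (measurableSet_closedBall.diff hm))
      · intro y a b
        refine ⟨by simpa using a.le, ?_⟩
        simp
        linarith
      · rintro y ⟨a, b⟩
        refine ⟨by simpa using a, ?_⟩
        simp at b
        linarith
    rw [e2, EuclideanSpace.volume_closedBall_fin_three] at e
    simp only [ENNReal.ofReal_one, one_pow, one_mul] at e
    have e3 : ENNReal.ofReal (Real.pi * 4 / 3) = ENNReal.ofReal (2 * Real.pi / 3 * (1 - c)) +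
        ENNReal.ofReal (2 * Real.pi / 3 * (1 - -c)) := by
      have := Real.pi_pos
      rw [← ENNReal.ofReal_add]
      · congr 1; ring
      · apply mul_nonneg (by positivity); linarith
      · apply mul_nonneg (by positivity); linarith
    rw [e3] at e
    exact (ENNReal.add_left_inj ENNReal.ofReal_ne_top).1 e

lemma sphere_fin (ρ : ℝ) (hρ : 0 < ρ) : μH[2] (Metric.sphere (0 : (EuclideanSpace ℝ (Fin 3))) ρ) ≠ ⊤ := by
  let f : (Fin 2 → ℝ) → (EuclideanSpace ℝ (Fin 3)) := fun a => WithLp.toLp 2 ![ρ * (2 * a 0) / (1 + a 0 ^ 2 + a 1 ^ 2),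
    ρ * (2 * a 1) / (1 + a 0 ^ 2 + a 1 ^ 2), ρ * (1 - a 0 ^ 2 - a 1 ^ 2) / (1 + a 0 ^ 2 + a 1 ^ 2)]
  let B : Set (Fin 2 → ℝ) := Set.Icc (fun _ => -1) (fun _ => 1)
  have hf : ContDiff ℝ 1 f := by
    rw [contDiff_euclidean]
    intro i
    have hd : ∀ a : Fin 2 → ℝ, 1 + a 0 ^ 2 + a 1 ^ 2 ≠ 0 := fun a => by positivity
    fin_cases i <;> simp [f] <;>
    · refine ContDiff.div ?_ ?_ hd <;> fun_prop
  obtain ⟨K, hK⟩ := hf.contDiffOn.exists_lipschitzOnWith (s := B) one_ne_zero (convex_Icc _ _) isCompact_Icc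
  have h2 : (μH[2] : Measure (Fin 2 → ℝ)) = volume := by
    have := @hausdorffMeasure_pi_real (Fin 2) _
    simpa using this
  have hB : μH[2] (f '' B) ≠ ⊤ := by
    apply ne_top_of_le_ne_top _ (hK.hausdorffMeasure_image_le (d := 2) (by norm_num))
    rw [h2]
    exact ENNReal.mul_ne_top (by simp) isCompact_Icc.measure_ne_top
  have hB' : μH[2] ((LinearIsometryEquiv.neg ℝ (E := (EuclideanSpace ℝ (Fin 3)))).toIsometryEquiv '' (f '' B)) ≠ ⊤ := by
    rw [IsometryEquiv.hausdorffMeasure_image]; exact hB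
  have main : ∀ x : (EuclideanSpace ℝ (Fin 3)), ‖x‖ = ρ → 0 ≤ x 2 → x ∈ f '' B := by
    intro x hx h
    have hs : x 0 ^ 2 + x 1 ^ 2 + x 2 ^ 2 = ρ ^ 2 := by
      rw [← hx, EuclideanSpace.norm_sq_eq]; simp [Fin.sum_univ_three]
    have hp : 0 < ρ + x 2 := by linarith
    have bd : ∀ s : ℝ, s ^ 2 ≤ ρ ^ 2 → -1 ≤ s / (ρ + x 2) ∧ s / (ρ + x 2) ≤ 1 := by
      intro s hs
      have := abs_le.1 (abs_le_of_sq_le_sq hs hρ.le)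
      rw [le_div_iff₀ hp, div_le_iff₀ hp]
      constructor <;> linarith
    have b0 := bd (x 0) (by nlinarith [sq_nonneg (x 1), sq_nonneg (x 2)])
    have b1 := bd (x 1) (by nlinarith [sq_nonneg (x 0), sq_nonneg (x 2)])
    have hden : 1 + (x 0 / (ρ + x 2)) ^ 2 + (x 1 / (ρ + x 2)) ^ 2 = 2 * ρ / (ρ + x 2) := by
      field_simp; nlinarith
    have hnum : 1 - (x 0 / (ρ + x 2)) ^ 2 - (x 1 / (ρ + x 2)) ^ 2 = 2 * x 2 / (ρ + x 2) := by
      field_simp; nlinarith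
    refine ⟨![x 0 / (ρ + x 2), x 1 / (ρ + x 2)], ⟨?_, ?_⟩, ?_⟩
    · intro i; fin_cases i <;> simp <;> linarith
    · intro i; fin_cases i <;> simp <;> linarith
    · ext i
      fin_cases i <;> simp [f, hden, hnum] <;> field_simp
  refine ne_top_of_le_ne_top (ENNReal.add_ne_top.2 ⟨hB, hB'⟩)
    ((measure_mono ?_).trans (measure_union_le _ _))
  intro x hx
  have hx : ‖x‖ = ρ := by simpa using hx
  rcases le_total 0 (x 2) with h | h
  · exact Or.inl (main x hx h)
  · refine Or.inr ⟨-x, main (-x) (by simpa using hx) (by simpa using h), by simp⟩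

lemma sphere_pos (ρ : ℝ) (hρ : 0 < ρ) : μH[2] (Metric.sphere (0 : (EuclideanSpace ℝ (Fin 3))) ρ) ≠ 0 := by
  let g : (EuclideanSpace ℝ (Fin 3)) → (Fin 2 → ℝ) := fun x => ![x 0, x 1]
  have hg : LipschitzWith 1 g := by
    apply LipschitzWith.of_dist_le_mul
    intro x y
    rw [NNReal.coe_one, one_mul, dist_pi_le_iff dist_nonneg]
    intro i
    have := fun j => PiLp.norm_apply_le (x - y) j
    rw [dist_eq_norm x y, Real.dist_eq]
    fin_cases i <;> simpa [g] using this _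
  have h2 : (μH[2] : Measure (Fin 2 → ℝ)) = volume := by
    have := @hausdorffMeasure_pi_real (Fin 2) _
    simpa using this
  have := (hg.lipschitzOnWith (s := Metric.sphere (0 : (EuclideanSpace ℝ (Fin 3))) ρ)).hausdorffMeasure_image_le
    (d := 2) (by norm_num)
  rw [h2] at this
  intro h0
  rw [h0, mul_zero, nonpos_iff_eq_zero] at this
  have hsub : Metric.ball (0 : Fin 2 → ℝ) (ρ / 2) ⊆ g '' Metric.sphere (0 : (EuclideanSpace ℝ (Fin 3))) ρ := by
    intro a ha
    rw [mem_ball_zero_iff, pi_norm_lt_iff (by positivity)] at ha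
    have a0 := abs_lt.1 (ha 0)
    have a1 := abs_lt.1 (ha 1)
    have hnn : 0 ≤ ρ ^ 2 - a 0 ^ 2 - a 1 ^ 2 := by nlinarith
    refine ⟨WithLp.toLp 2 ![a 0, a 1, √(ρ ^ 2 - a 0 ^ 2 - a 1 ^ 2)], ?_, ?_⟩
    · rw [mem_sphere_zero_iff_norm, EuclideanSpace.norm_eq, Real.sqrt_eq_iff_mul_self_eq_of_pos hρ]
      simp [Fin.sum_univ_three, Real.sq_sqrt hnn]
      ring
    · ext i; fin_cases i <;> simp [g]
  exact (Metric.measure_ball_pos volume (0 : Fin 2 → ℝ) (r := ρ / 2) (by positivity)).ne'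
    (measure_mono_null hsub this)

/-- Any measure preserved by linear isometries gives the same mass to all caps. -/
lemma cap_congr (m : Measure (EuclideanSpace ℝ (Fin 3))) (hm : ∀ e : (EuclideanSpace ℝ (Fin 3)) ≃ₗᵢ[ℝ] (EuclideanSpace ℝ (Fin 3)), MeasurePreserving e m m)
    (k : (EuclideanSpace ℝ (Fin 3)) → ℝ) (hk : Continuous k) (hk' : ∀ e : (EuclideanSpace ℝ (Fin 3)) ≃ₗᵢ[ℝ] (EuclideanSpace ℝ (Fin 3)), ∀ x, k (e x) = k x)
    (v w : (EuclideanSpace ℝ (Fin 3))) (h : ‖v‖ = ‖w‖) :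
    m {x | k x ≤ inner ℝ x v} = m {x | k x ≤ inner ℝ x w} := by
  have hms : MeasurableSet {x : (EuclideanSpace ℝ (Fin 3)) | k x ≤ inner ℝ x w} :=
    (isClosed_le hk (by fun_prop)).measurableSet
  set R := (ℝ ∙ (v - w))ᗮ.reflection with hR
  have hRv : R v = w := Submodule.reflection_sub h
  rw [← (hm R).measure_preimage hms.nullMeasurableSet]
  congr 1
  ext x
  simp only [Set.mem_preimage, Set.mem_ofPred_eq, hk']
  rw [← hRv, LinearIsometryEquiv.inner_map_map]

lemma restrict_mp (m : Measure (EuclideanSpace ℝ (Fin 3))) (hm : ∀ e : (EuclideanSpace ℝ (Fin 3)) ≃ₗᵢ[ℝ] (EuclideanSpace ℝ (Fin 3)), MeasurePreserving e m m)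
    (s : Set (EuclideanSpace ℝ (Fin 3))) (hs : MeasurableSet s) (h : ∀ e : (EuclideanSpace ℝ (Fin 3)) ≃ₗᵢ[ℝ] (EuclideanSpace ℝ (Fin 3)), e ⁻¹' s = s)
    (e : (EuclideanSpace ℝ (Fin 3)) ≃ₗᵢ[ℝ] (EuclideanSpace ℝ (Fin 3))) : MeasurePreserving e (m.restrict s) (m.restrict s) := by
  have := (hm e).restrict_preimage hs
  rwa [h] at this

lemma cap_measure (ρ : ℝ) (hρ : 0 < ρ) (c : ℝ) (h0 : -1 ≤ c) (hc1 : c ≤ 1) (u : (EuclideanSpace ℝ (Fin 3))) (hu : 0 < ‖u‖) :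
    ((μH[2] : Measure (EuclideanSpace ℝ (Fin 3))).restrict (Metric.sphere 0 ρ)) {x | c * ρ * ‖u‖ ≤ inner ℝ x u} =
      μH[2] (Metric.sphere (0 : (EuclideanSpace ℝ (Fin 3))) ρ) * ENNReal.ofReal ((1 - c) / 2) := by
  set m := (μH[2] : Measure (EuclideanSpace ℝ (Fin 3))).restrict (Metric.sphere 0 ρ) with hm
  set n := (volume : Measure (EuclideanSpace ℝ (Fin 3))).restrict (Metric.closedBall 0 1) with hn
  have : IsFiniteMeasure m := ⟨by
    rw [hm, Measure.restrict_apply_univ]; exact (sphere_fin ρ hρ).lt_top⟩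
  have mi : ∀ e : (EuclideanSpace ℝ (Fin 3)) ≃ₗᵢ[ℝ] (EuclideanSpace ℝ (Fin 3)), MeasurePreserving e m m :=
    restrict_mp _ (fun e => e.toIsometryEquiv.measurePreserving_hausdorffMeasure 2) _
      Metric.isClosed_sphere.measurableSet (fun e => by ext x; simp)
  have ni : ∀ e : (EuclideanSpace ℝ (Fin 3)) ≃ₗᵢ[ℝ] (EuclideanSpace ℝ (Fin 3)), MeasurePreserving e n n :=
    restrict_mp _ (fun e => e.measurePreserving) _
      measurableSet_closedBall (fun e => by ext x; simp)
  have hK : MeasurableSet {p : (EuclideanSpace ℝ (Fin 3)) × (EuclideanSpace ℝ (Fin 3)) | c * ρ * ‖p.2‖ ≤ inner ℝ p.1 p.2} :=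
    (isClosed_le (by fun_prop) (by fun_prop)).measurableSet
  have e1 := Measure.prod_apply (μ := m) (ν := n) hK
  have e2 := Measure.prod_apply_symm (μ := m) (ν := n) hK
  have i1 : ∀ᵐ x ∂m, n (Prod.mk x ⁻¹' {p : (EuclideanSpace ℝ (Fin 3)) × (EuclideanSpace ℝ (Fin 3)) | c * ρ * ‖p.2‖ ≤ inner ℝ p.1 p.2}) =
      ENNReal.ofReal (2 * Real.pi / 3 * (1 - c)) := by
    filter_upwards [ae_restrict_mem Metric.isClosed_sphere.measurableSet] with x hx
    have hx : ‖x‖ = ρ := by simpa using hx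
    have := cap_congr n ni (fun y => c * ρ * ‖y‖) (by fun_prop) (by simp) x
      (ρ • EuclideanSpace.single 0 1) (by simp [hx, norm_smul, abs_of_pos hρ])
    rw [← sector_vol' c h0 hc1]
    trans n {y | c * ρ * ‖y‖ ≤ inner ℝ y x}
    · congr 1; ext y; simp [real_inner_comm]
    rw [this, hn, Measure.restrict_apply (isClosed_le (by fun_prop) (by fun_prop)).measurableSet,
      Set.inter_comm]
    congr 2
    ext y
    simp only [Set.mem_ofPred_eq, inner_smul_right, EuclideanSpace.inner_single_right]
    simp
    rw [show c * ρ * ‖y‖ = ρ * (c * ‖y‖) by ring, mul_le_mul_iff_right₀ hρ]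
  have i2 : ∀ᵐ y ∂n, m ((fun x => (x, y)) ⁻¹' {p : (EuclideanSpace ℝ (Fin 3)) × (EuclideanSpace ℝ (Fin 3)) | c * ρ * ‖p.2‖ ≤ inner ℝ p.1 p.2}) =
      m {x | c * ρ * ‖u‖ ≤ inner ℝ x u} := by
    have : ∀ᵐ y ∂n, y ≠ 0 := by
      apply ae_restrict_of_ae
      simp [ae_iff]
    filter_upwards [this] with y hy
    have hy : 0 < ‖y‖ := norm_pos_iff.2 hy
    have := cap_congr m mi (fun _ => c * ρ * ‖u‖) (by fun_prop) (by simp) ((‖u‖ / ‖y‖) • y) u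
      (by rw [norm_smul, norm_div, norm_norm, norm_norm]; field_simp)
    rw [← this]
    congr 1
    ext x
    simp only [Set.mem_preimage, Set.mem_ofPred_eq, inner_smul_right]
    rw [div_mul_eq_mul_div, le_div_iff₀ hy,
      show c * ρ * ‖u‖ * ‖y‖ = ‖u‖ * (c * ρ * ‖y‖) by ring, mul_le_mul_iff_right₀ hu]
  rw [lintegral_congr_ae i1, lintegral_const] at e1
  rw [lintegral_congr_ae i2, lintegral_const, e1] at e2
  rw [hn, hm, Measure.restrict_apply_univ, Measure.restrict_apply_univ, ← hm,
    EuclideanSpace.volume_closedBall_fin_three] at e2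
  simp only [ENNReal.ofReal_one, one_pow, one_mul] at e2
  have pp := Real.pi_pos
  have e3 : ENNReal.ofReal (2 * Real.pi / 3 * (1 - c)) =
      ENNReal.ofReal ((1 - c) / 2) * ENNReal.ofReal (Real.pi * 4 / 3) := by
    rw [← ENNReal.ofReal_mul (by linarith)]; congr 1; ring
  rw [e3, mul_right_comm] at e2
  exact ((ENNReal.mul_left_inj (by simp; positivity) ENNReal.ofReal_ne_top).1 e2).symm.trans
    (mul_comm _ _)

/-- **Lemma 1 (CDF part).** The CDF of the distance from a user on Earth's surface to a
satellite uniformly distributed on the sphere of radius `r⊕ + rmin`. -/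
theorem uniform_sphere_distance_cdf
    (rE rmin ρ : ℝ) (hrE : 0 < rE) (hrmin : 0 < rmin) (hρ : ρ = rE + rmin)
    (S : Set (EuclideanSpace ℝ (Fin 3)))
    (hS : S = Metric.sphere (0 : EuclideanSpace ℝ (Fin 3)) ρ)
    (u : EuclideanSpace ℝ (Fin 3)) (hu : ‖u‖ = rE)
    (μ : Measure (EuclideanSpace ℝ (Fin 3)))
    (hμ : μ = (μH[2] S)⁻¹ •
      ((μH[2] : Measure (EuclideanSpace ℝ (Fin 3))).restrict S)) :
    (∀ r : ℝ, rmin ≤ r → r ≤ 2 * rE + rmin →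
      μ {x ∈ S | ‖x - u‖ ≤ r} =
        ENNReal.ofReal ((r ^ 2 - rmin ^ 2) / (4 * rE * (rE + rmin)))) ∧
    (∀ r : ℝ, r < rmin → μ {x ∈ S | ‖x - u‖ ≤ r} = 0) ∧
    (∀ r : ℝ, 2 * rE + rmin < r → μ {x ∈ S | ‖x - u‖ ≤ r} = 1) := by
  have hρ0 : 0 < ρ := by linarith
  have hfin := sphere_fin ρ hρ0
  have hpos := sphere_pos ρ hρ0
  rw [← hS] at hfin hpos
  have hSm : MeasurableSet S := by rw [hS]; exact Metric.isClosed_sphere.measurableSet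
  have hn : ∀ x ∈ S, ‖x‖ = ρ := by intro x hx; simpa [hS] using hx
  refine ⟨?_, ?_, ?_⟩
  · intro r h1 h2
    set c := (ρ ^ 2 + rE ^ 2 - r ^ 2) / (2 * ρ * rE) with hc
    have hd : 0 < 2 * ρ * rE := by positivity
    have hcm : -1 ≤ c := by
      rw [hc, le_div_iff₀ hd, hρ]; nlinarith
    have hcM : c ≤ 1 := by
      rw [hc, div_le_iff₀ hd, hρ]; nlinarith
    have hcap := cap_measure ρ hρ0 c hcm hcM u (by linarith)
    rw [← hS, Measure.restrict_apply (isClosed_le (by fun_prop) (by fun_prop)).measurableSet] at hcap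
    have hset : {x ∈ S | ‖x - u‖ ≤ r} = {x | c * ρ * ‖u‖ ≤ inner ℝ x u} ∩ S := by
      ext x
      simp only [Set.mem_inter_iff, Set.mem_ofPred_eq]
      rw [and_comm]
      refine and_congr_left fun hx => ?_
      have e : c * ρ * ‖u‖ = (ρ ^ 2 + rE ^ 2 - r ^ 2) / 2 := by
        rw [hc, hu]; field_simp
      have e2 := norm_sub_sq_real x u
      rw [hn x hx, hu] at e2
      rw [e, ← sq_le_sq₀ (norm_nonneg _) (by linarith), e2]
      constructor <;> intro h <;> linarith
    have hsub : {x ∈ S | ‖x - u‖ ≤ r} ⊆ S := fun x hx => hx.1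
    rw [hμ, Measure.smul_apply, Measure.restrict_eq_self _ hsub, hset, hcap, smul_eq_mul,
      ← mul_assoc, ENNReal.inv_mul_cancel hpos hfin, one_mul]
    congr 1
    rw [hc, ← hρ, show rmin = ρ - rE by linarith]
    field_simp
    ring
  · intro r hr
    have : {x ∈ S | ‖x - u‖ ≤ r} = ∅ := by
      ext x
      simp only [Set.mem_ofPred_eq, Set.mem_empty_iff_false, iff_false]
      rintro ⟨hx, h⟩
      have := norm_sub_norm_le x u
      rw [hn x hx, hu] at this
      linarith
    rw [this]; simp
  · intro r hr
    have : {x ∈ S | ‖x - u‖ ≤ r} = S := by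
      ext x
      simp only [Set.mem_ofPred_eq, and_iff_left_iff_imp]
      intro hx
      have := norm_sub_le x u
      rw [hn x hx, hu] at this
      linarith
    rw [this, hμ, Measure.smul_apply, Measure.restrict_apply_self, smul_eq_mul,
      ENNReal.inv_mul_cancel hpos hfin]
end

section
/- Let r⊕ > 0 and rmin > 0 be real numbers, let ρ = r⊕ + rmin, let S be the sphere of radius ρ centered at the origin in EuclideanSpace ℝ (Fin 3), let u be a fixed point with ‖u‖ = r⊕, and let μ be the uniform probability measure on S (the 2-dimensional Hausdorff measure restricted to S, normalized to total mass 1). Then the pushforward of μ under the map x ↦ ‖x − u‖ is absolutely continuous with respect to Lebesgue measure on ℝ, with density f_R(r) = r / (2·r⊕·(r⊕ + rmin)) for rmin ≤ r ≤ 2·r⊕ + rmin and f_R(r) = 0 otherwise. -/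
open MeasureTheory Set
open scoped ENNReal NNReal

lemma sphere_hausdorff_lt_top (ρ : ℝ) (hρ : 0 < ρ) :
    (μH[2] : Measure (EuclideanSpace ℝ (Fin 3))) (Metric.sphere 0 ρ) < ⊤ := by
  let f : (Fin 2 → ℝ) → EuclideanSpace ℝ (Fin 3) := fun v =>
    !₂[ρ * Real.cos (v 0), ρ * Real.sin (v 0) * Real.cos (v 1), ρ * Real.sin (v 0) * Real.sin (v 1)]
  let B : Set (Fin 2 → ℝ) := Set.Icc ![0, -Real.pi] ![Real.pi, Real.pi]
  have hf : ContDiff ℝ 1 f := by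
    rw [contDiff_euclidean]
    intro i
    fin_cases i <;> simp [f] <;> fun_prop
  obtain ⟨K, hK⟩ := hf.contDiffOn.exists_lipschitzOnWith (s := B) one_ne_zero
    (convex_Icc _ _) isCompact_Icc
  have hsub : Metric.sphere (0 : EuclideanSpace ℝ (Fin 3)) ρ ⊆ f '' B := by
    intro x hx
    rw [mem_sphere_zero_iff_norm, EuclideanSpace.norm_eq, Real.sqrt_eq_iff_mul_self_eq_of_pos hρ] at hx
    simp only [Fin.sum_univ_three, Real.norm_eq_abs, sq_abs] at hx
    set z : ℂ := ⟨x 1, x 2⟩ with hz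
    have hz2 : ‖z‖ ^ 2 = x 1 ^ 2 + x 2 ^ 2 := by
      rw [Complex.sq_norm, Complex.normSq_mk]; ring
    have hle : |x 0| ≤ ρ := abs_le_of_sq_le_sq (by nlinarith [sq_nonneg (x 1), sq_nonneg (x 2)]) hρ.le
    rw [abs_le] at hle
    have hsin : ρ * Real.sin (Real.arccos (x 0 / ρ)) = ‖z‖ := by
      rw [Real.sin_arccos]
      have h1 : 1 - (x 0 / ρ) ^ 2 = (‖z‖ / ρ) ^ 2 := by
        field_simp
        rw [hz2]; linarith
      rw [h1, Real.sqrt_sq (by positivity)]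
      field_simp
    refine ⟨![Real.arccos (x 0 / ρ), Complex.arg z], ⟨?_, ?_⟩, ?_⟩
    · intro i; fin_cases i
      · simpa using Real.arccos_nonneg _
      · simpa using (Complex.neg_pi_lt_arg z).le
    · intro i; fin_cases i
      · simpa using Real.arccos_le_pi _
      · simpa using Complex.arg_le_pi z
    · ext i
      fin_cases i
      · simp only [f]
        simp
        rw [Real.cos_arccos]
        · field_simp
        · rw [le_div_iff₀ hρ]; linarith
        · rw [div_le_iff₀ hρ]; linarith
      · simp [f]
        rw [hsin, Complex.norm_mul_cos_arg]
      · simp [f]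
        rw [hsin, Complex.norm_mul_sin_arg]
  refine (measure_mono hsub).trans_lt ?_
  refine (hK.hausdorffMeasure_image_le (by norm_num)).trans_lt ?_
  have h2 : (μH[2] : Measure (Fin 2 → ℝ)) = volume := by
    have := hausdorffMeasure_pi_real (ι := Fin 2)
    simpa using this
  rw [h2]
  refine ENNReal.mul_lt_top ?_ isCompact_Icc.measure_lt_top
  exact ENNReal.rpow_lt_top_of_nonneg (by norm_num) (by simp)

lemma sphere_hausdorff_ne_zero (ρ : ℝ) (hρ : 0 < ρ) :
    (μH[2] : Measure (EuclideanSpace ℝ (Fin 3))) (Metric.sphere 0 ρ) ≠ 0 := by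
  let g : EuclideanSpace ℝ (Fin 3) → (Fin 2 → ℝ) := fun x => ![x 0, x 1]
  have hg : LipschitzWith 1 g := by
    refine LipschitzWith.of_dist_le_mul fun x y => ?_
    rw [NNReal.coe_one, one_mul, dist_pi_le_iff dist_nonneg]
    intro i
    rw [EuclideanSpace.dist_eq]
    apply Real.le_sqrt_of_sq_le
    simp only [Fin.sum_univ_three]
    fin_cases i
    · simp [g]
      nlinarith [sq_nonneg (dist (x 1) (y 1)), sq_nonneg (dist (x 2) (y 2))]
    · simp [g]
      nlinarith [sq_nonneg (dist (x 0) (y 0)), sq_nonneg (dist (x 2) (y 2))]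
  have h2 : (μH[2] : Measure (Fin 2 → ℝ)) = volume := by
    have := hausdorffMeasure_pi_real (ι := Fin 2)
    simpa using this
  have hsub : Metric.ball (0 : Fin 2 → ℝ) (ρ / 2) ⊆ g '' Metric.sphere 0 ρ := by
    intro v hv
    rw [mem_ball_zero_iff, pi_norm_lt_iff (by positivity)] at hv
    have h0 := hv 0
    have h1 := hv 1
    rw [Real.norm_eq_abs] at h0 h1
    have h0' := sq_lt_sq' (abs_lt.1 h0).1 (abs_lt.1 h0).2
    have h1' := sq_lt_sq' (abs_lt.1 h1).1 (abs_lt.1 h1).2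
    refine ⟨!₂[v 0, v 1, Real.sqrt (ρ ^ 2 - v 0 ^ 2 - v 1 ^ 2)], ?_, ?_⟩
    · rw [mem_sphere_zero_iff_norm, EuclideanSpace.norm_eq, Real.sqrt_eq_iff_mul_self_eq_of_pos hρ]
      simp [Fin.sum_univ_three]
      rw [Real.sq_sqrt (by nlinarith)]
      ring
    · ext i; fin_cases i <;> simp [g]
  intro h
  have h3 := hg.hausdorffMeasure_image_le (d := 2) (by norm_num) (Metric.sphere 0 ρ)
  rw [h, mul_zero, h2] at h3
  have h4 : volume (Metric.ball (0 : Fin 2 → ℝ) (ρ / 2)) ≤ 0 := (measure_mono hsub).trans h3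
  exact absurd h4 (not_le.2 (Metric.measure_ball_pos _ _ (by positivity)))

lemma planar_radial (h : ℝ → ℝ≥0∞) (hh : Measurable h) :
    ∫⁻ p : ℝ × ℝ, h (p.1 ^ 2 + p.2 ^ 2) = ENNReal.ofReal Real.pi * ∫⁻ t in Ioi (0 : ℝ), h t := by
  rw [← lintegral_comp_polarCoord_symm]
  have h1 : ∀ p : ℝ × ℝ, ENNReal.ofReal p.1 •
      h ((polarCoord.symm p).1 ^ 2 + (polarCoord.symm p).2 ^ 2) = ENNReal.ofReal p.1 * h (p.1 ^ 2) := by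
    intro p
    rw [smul_eq_mul, polarCoord_symm_apply]
    congr 2
    have := Real.cos_sq_add_sin_sq p.2
    linear_combination p.1 ^ 2 * this
  simp_rw [h1]
  have himg : (fun r : ℝ => r ^ 2) '' Ioi 0 = Ioi 0 := by
    ext t
    constructor
    · rintro ⟨r, hr, rfl⟩
      exact pow_pos (mem_Ioi.1 hr) 2
    · intro ht
      exact ⟨Real.sqrt t, Real.sqrt_pos.2 ht, Real.sq_sqrt (le_of_lt ht)⟩
  have h2 : ∫⁻ t in Ioi (0 : ℝ), h t = ∫⁻ r in Ioi (0 : ℝ), 2 * (ENNReal.ofReal r * h (r ^ 2)) := by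
    conv_lhs => rw [← himg]
    rw [lintegral_image_eq_lintegral_abs_deriv_mul (f' := fun r => 2 * r) measurableSet_Ioi]
    · refine setLIntegral_congr_fun measurableSet_Ioi fun r hr => ?_
      have hr' : (0 : ℝ) < r := hr
      rw [abs_of_pos (by positivity), ENNReal.ofReal_mul (by norm_num), mul_assoc]
      simp
    · intro r _
      have := (hasDerivAt_pow 2 r).hasDerivWithinAt (s := Ioi 0)
      simpa using this
    · intro a ha b hb hab
      have ha' : (0 : ℝ) < a := ha
      have hb' : (0 : ℝ) < b := hb
      exact (pow_left_inj₀ ha'.le hb'.le two_ne_zero).1 hab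
  have hm : Measurable fun r : ℝ => ENNReal.ofReal r * h (r ^ 2) := by fun_prop
  rw [h2, lintegral_const_mul _ hm, polarCoord_target, Measure.volume_eq_prod,
    ← Measure.prod_restrict, lintegral_prod _ (by fun_prop)]
  simp only [lintegral_const, Measure.restrict_apply_univ, Real.volume_Ioo]
  rw [lintegral_mul_const _ hm, mul_comm, ← mul_assoc]
  congr 1
  rw [show Real.pi - -Real.pi = Real.pi * 2 by ring, ENNReal.ofReal_mul Real.pi_pos.le]
  simp

lemma space_radial (F : ℝ → ℝ → ℝ≥0∞) (hF : Measurable (Function.uncurry F)) :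
    ∫⁻ y : EuclideanSpace ℝ (Fin 3), F (y 0) (y 1 ^ 2 + y 2 ^ 2) =
      ENNReal.ofReal Real.pi * ∫⁻ z, ∫⁻ t in Ioi (0 : ℝ), F z t := by
  have e1 := PiLp.volume_preserving_ofLp (Fin 3)
  have e2 := volume_preserving_piFinSuccAbove (fun _ : Fin 3 => ℝ) 0
  have e3 : MeasurePreserving (Prod.map id (MeasurableEquiv.finTwoArrow (α := ℝ)))
      (volume : Measure (ℝ × (Fin 2 → ℝ))) (volume : Measure (ℝ × ℝ × ℝ)) :=
    (MeasurePreserving.id volume).prod (volume_preserving_finTwoArrow ℝ)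
  have e := e3.comp (e2.comp e1)
  have hG : Measurable fun p : ℝ × ℝ × ℝ => F p.1 (p.2.1 ^ 2 + p.2.2 ^ 2) :=
    hF.comp (f := fun p : ℝ × ℝ × ℝ => (p.1, p.2.1 ^ 2 + p.2.2 ^ 2)) (by fun_prop)
  have h1 := e.lintegral_comp hG
  have h2 : ∫⁻ y : EuclideanSpace ℝ (Fin 3), F (y 0) (y 1 ^ 2 + y 2 ^ 2) =
      ∫⁻ p : ℝ × ℝ × ℝ, F p.1 (p.2.1 ^ 2 + p.2.2 ^ 2) := by
    rw [← h1]
    rfl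
  rw [h2, Measure.volume_eq_prod, lintegral_prod _ hG.aemeasurable]
  simp only
  have h3 : ∀ z, ∫⁻ p : ℝ × ℝ, F z (p.1 ^ 2 + p.2 ^ 2) =
      ENNReal.ofReal Real.pi * ∫⁻ t in Ioi (0 : ℝ), F z t := fun z =>
    planar_radial (F z) (hF.comp (f := fun t => (z, t)) (by fun_prop))
  simp_rw [h3]
  rw [lintegral_const_mul]
  exact Measurable.lintegral_prod_right hF

lemma scale_interval (ρ q : ℝ) (hρ : 0 < ρ) (hq : 0 < q) (f : ℝ → ℝ≥0∞) :
    ∫⁻ z in {z : ℝ | z ^ 2 < q}, f (ρ * z / Real.sqrt q) =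
      ENNReal.ofReal (Real.sqrt q / ρ) * ∫⁻ s in Ioo (-ρ) ρ, f s := by
  have hs : 0 < Real.sqrt q := Real.sqrt_pos.2 hq
  have himg : (fun s : ℝ => s * (Real.sqrt q / ρ)) '' Ioo (-ρ) ρ = {z : ℝ | z ^ 2 < q} := by
    ext z
    have key : z ^ 2 < q ↔ -Real.sqrt q < z ∧ z < Real.sqrt q := by
      rw [← abs_lt, ← Real.sqrt_lt_sqrt_iff (sq_nonneg z), Real.sqrt_sq_eq_abs]
    rw [mem_ofPred_eq, key]
    constructor
    · rintro ⟨s, ⟨h1, h2⟩, rfl⟩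
      have hc : 0 < Real.sqrt q / ρ := by positivity
      have e : ρ * (Real.sqrt q / ρ) = Real.sqrt q := by field_simp
      constructor
      · have := mul_lt_mul_of_pos_right h1 hc
        simp only; linarith
      · have := mul_lt_mul_of_pos_right h2 hc
        simp only; linarith
    · rintro ⟨h1, h2⟩
      refine ⟨z * (ρ / Real.sqrt q), ⟨?_, ?_⟩, by field_simp⟩
      · rw [mul_div_assoc', lt_div_iff₀ hs]; nlinarith
      · rw [mul_div_assoc', div_lt_iff₀ hs]; nlinarith
  rw [← himg, lintegral_image_eq_lintegral_abs_deriv_mul (f' := fun _ => Real.sqrt q / ρ)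
    measurableSet_Ioo]
  · rw [← lintegral_const_mul' _ _ ENNReal.ofReal_ne_top]
    refine lintegral_congr fun s => ?_
    rw [abs_of_pos (by positivity)]
    congr 2
    field_simp
  · intro s _
    have := ((hasDerivAt_id s).mul_const (Real.sqrt q / ρ)).hasDerivWithinAt (s := Ioo (-ρ) ρ)
    simpa using this
  · intro a _ b _ hab
    exact mul_right_cancel₀ (by positivity) hab

lemma ball_height (ρ : ℝ) (hρ : 0 < ρ) : ∃ C : ℝ≥0∞, ∀ f : ℝ → ℝ≥0∞, Measurable f →
    ∫⁻ y in Metric.ball (0 : EuclideanSpace ℝ (Fin 3)) 1, f (ρ * y 0 / ‖y‖) =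
      C * ∫⁻ s in Ioo (-ρ) ρ, f s := by
  refine ⟨ENNReal.ofReal Real.pi * ∫⁻ q in Ioo (0 : ℝ) 1, ENNReal.ofReal (Real.sqrt q / ρ), ?_⟩
  intro f hf
  let G : ℝ → ℝ → ℝ≥0∞ := fun z q => {q : ℝ | q < 1}.indicator (fun q => f (ρ * z / Real.sqrt q)) q
  have hGm : Measurable (Function.uncurry G) := by
    have : Function.uncurry G = {p : ℝ × ℝ | p.2 < 1}.indicator
        (fun p => f (ρ * p.1 / Real.sqrt p.2)) := by
      ext ⟨a, b⟩; rfl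
    rw [this]
    refine Measurable.indicator (by fun_prop) (measurableSet_lt (by fun_prop) (by fun_prop))
  have h1 : ∫⁻ y in Metric.ball (0 : EuclideanSpace ℝ (Fin 3)) 1, f (ρ * y 0 / ‖y‖) =
      ∫⁻ y : EuclideanSpace ℝ (Fin 3), (fun z t => G z (z ^ 2 + t)) (y 0) (y 1 ^ 2 + y 2 ^ 2) := by
    rw [← lintegral_indicator Metric.isOpen_ball.measurableSet]
    refine lintegral_congr fun y => ?_
    have hn : ‖y‖ = Real.sqrt (y 0 ^ 2 + (y 1 ^ 2 + y 2 ^ 2)) := by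
      rw [EuclideanSpace.norm_eq]; simp [Fin.sum_univ_three, add_assoc]
    have hiff : y ∈ Metric.ball (0 : EuclideanSpace ℝ (Fin 3)) 1 ↔
        y 0 ^ 2 + (y 1 ^ 2 + y 2 ^ 2) < 1 := by
      rw [mem_ball_zero_iff, hn, Real.sqrt_lt' one_pos, one_pow]
    simp only [G, indicator, mem_ofPred_eq, hiff, hn]
  rw [h1, space_radial (fun z t => G z (z ^ 2 + t)) (hGm.comp (f := fun p : ℝ × ℝ => (p.1, p.1 ^ 2 + p.2)) (by fun_prop)),
    mul_assoc]
  congr 1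
  have h2 : ∀ z : ℝ, ∫⁻ t in Ioi (0 : ℝ), G z (z ^ 2 + t) =
      ∫⁻ q, {p : ℝ × ℝ | p.1 ^ 2 < p.2}.indicator (Function.uncurry G) (z, q) := by
    intro z
    rw [← lintegral_indicator measurableSet_Ioi,
      ← lintegral_add_right_eq_self (μ := volume)
        (fun q => {p : ℝ × ℝ | p.1 ^ 2 < p.2}.indicator (Function.uncurry G) (z, q)) (z ^ 2)]
    refine lintegral_congr fun t => ?_
    simp [indicator, Function.uncurry, add_comm]
  simp_rw [h2]
  rw [lintegral_lintegral_swap]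
  swap
  · exact (hGm.indicator (measurableSet_lt (by fun_prop) (by fun_prop))).aemeasurable
  rw [← lintegral_mul_const, ← lintegral_indicator measurableSet_Ioo]
  swap
  · fun_prop
  refine lintegral_congr fun q => ?_
  by_cases hq : q ∈ Ioo (0 : ℝ) 1
  · rw [indicator_of_mem hq, ← scale_interval ρ q hρ hq.1, ← lintegral_indicator]
    · refine lintegral_congr fun z => ?_
      have := hq.2
      simp [indicator, Function.uncurry, G, this]
    · exact measurableSet_lt (by fun_prop) (by fun_prop)
  · rw [indicator_of_notMem hq]
    rw [lintegral_eq_zero_iff']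
    · refine Filter.Eventually.of_forall fun z => ?_
      simp only [indicator, Function.uncurry, G, mem_ofPred_eq, Pi.zero_apply]
      split_ifs with ha hb
      · exact absurd ⟨lt_of_le_of_lt (sq_nonneg z) ha, hb⟩ hq
      · rfl
      · rfl
    · exact ((hGm.indicator (measurableSet_lt (by fun_prop) (by fun_prop))).comp
        (f := fun z : ℝ => (z, q)) (by fun_prop)).aemeasurable

lemma sphere_height (ρ : ℝ) (hρ : 0 < ρ) (u : EuclideanSpace ℝ (Fin 3)) (hu : u ≠ 0) :
    ∃ D : ℝ≥0∞, ∀ f : ℝ → ℝ≥0∞, Measurable f →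
      ∫⁻ x in Metric.sphere (0 : EuclideanSpace ℝ (Fin 3)) ρ, f (inner ℝ x u / ‖u‖) ∂μH[2] =
        D * ∫⁻ s in Ioo (-ρ) ρ, f s := by
  obtain ⟨C, hC⟩ := ball_height ρ hρ
  set m : Measure (EuclideanSpace ℝ (Fin 3)) := μH[2].restrict (Metric.sphere 0 ρ) with hm
  have hmf : IsFiniteMeasure m := ⟨by
    rw [hm, Measure.restrict_apply_univ]; exact sphere_hausdorff_lt_top ρ hρ⟩
  set ν : Measure (EuclideanSpace ℝ (Fin 3)) := volume.restrict (Metric.ball 0 1) with hν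
  have hν0 : ν univ ≠ 0 := by
    rw [hν, Measure.restrict_apply_univ]
    exact (Metric.measure_ball_pos _ _ one_pos).ne'
  have hνt : ν univ ≠ ⊤ := by
    rw [hν, Measure.restrict_apply_univ]
    exact measure_ball_lt_top.ne
  have hνf : IsFiniteMeasure ν := ⟨hνt.lt_top⟩
  have hmR : ∀ R : EuclideanSpace ℝ (Fin 3) ≃ₗᵢ[ℝ] EuclideanSpace ℝ (Fin 3),
      MeasurePreserving R m m := by
    intro R
    have h := (R.toIsometryEquiv.measurePreserving_hausdorffMeasure 2).restrict_preimage
      (s := Metric.sphere 0 ρ) Metric.isClosed_sphere.measurableSet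
    have hp : R.toIsometryEquiv ⁻¹' (Metric.sphere 0 ρ) = Metric.sphere 0 ρ := by
      ext x; simp
    rw [hp] at h
    exact h
  have hνR : ∀ R : EuclideanSpace ℝ (Fin 3) ≃ₗᵢ[ℝ] EuclideanSpace ℝ (Fin 3),
      MeasurePreserving R ν ν := by
    intro R
    have h := (R.measurePreserving).restrict_preimage
      (s := Metric.ball 0 1) Metric.isOpen_ball.measurableSet
    have hp : R ⁻¹' (Metric.ball 0 1) = Metric.ball 0 1 := by
      ext x; simp
    rw [hp] at h
    exact h
  have hun : 0 < ‖u‖ := norm_pos_iff.2 hu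
  refine ⟨(ν univ)⁻¹ * (C * m univ), fun f hf => ?_⟩
  have hH : ∀ y : EuclideanSpace ℝ (Fin 3), y ≠ 0 →
      ∫⁻ x, f (inner ℝ x y / ‖y‖) ∂m = ∫⁻ x, f (inner ℝ x u / ‖u‖) ∂m := by
    intro y hy
    have hyn : 0 < ‖y‖ := norm_pos_iff.2 hy
    set w : EuclideanSpace ℝ (Fin 3) := (‖y‖ / ‖u‖) • u with hw
    have hnorm : ‖y‖ = ‖w‖ := by
      rw [hw, norm_smul, Real.norm_of_nonneg (by positivity)]; field_simp
    set R := Submodule.reflection (Submodule.span ℝ {y - w})ᗮ with hR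
    have hRy : R y = w := Submodule.reflection_sub hnorm
    rw [← (hmR R).lintegral_comp (f := fun x => f (inner ℝ x u / ‖u‖)) (by fun_prop)]
    refine lintegral_congr fun x => ?_
    congr 1
    rw [← R.inner_map_map x y, hRy, hw, inner_smul_right]
    field_simp
  have hK : ∀ x ∈ Metric.sphere (0 : EuclideanSpace ℝ (Fin 3)) ρ,
      ∫⁻ y, f (inner ℝ x y / ‖y‖) ∂ν = C * ∫⁻ s in Ioo (-ρ) ρ, f s := by
    intro x hx
    rw [mem_sphere_zero_iff_norm] at hx
    set w : EuclideanSpace ℝ (Fin 3) := EuclideanSpace.single 0 ρ with hw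
    have hnorm : ‖x‖ = ‖w‖ := by
      rw [hw, PiLp.norm_single, hx, Real.norm_of_nonneg hρ.le]
    set R := Submodule.reflection (Submodule.span ℝ {x - w})ᗮ with hR
    have hRx : R x = w := Submodule.reflection_sub hnorm
    have hm0 : Measurable fun y : EuclideanSpace ℝ (Fin 3) => f (ρ * y 0 / ‖y‖) := by fun_prop
    rw [← hC f hf, ← (hνR R).lintegral_comp hm0]
    refine lintegral_congr fun y => ?_
    rw [← R.inner_map_map x y, hRx, hw, R.norm_map, EuclideanSpace.inner_single_left]
    simp
  have hmeas : Measurable (Function.uncurry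
      fun (x y : EuclideanSpace ℝ (Fin 3)) => f (inner ℝ x y / ‖y‖)) := by
    unfold Function.uncurry
    fun_prop
  have hswap := lintegral_lintegral_swap (μ := m) (ν := ν) hmeas.aemeasurable
  have hl : ∫⁻ x, ∫⁻ y, f (inner ℝ x y / ‖y‖) ∂ν ∂m = C * (∫⁻ s in Ioo (-ρ) ρ, f s) * m univ := by
    rw [hm, setLIntegral_congr_fun Metric.isClosed_sphere.measurableSet hK, lintegral_const]
  have hr : ∫⁻ y, ∫⁻ x, f (inner ℝ x y / ‖y‖) ∂m ∂ν =
      (∫⁻ x, f (inner ℝ x u / ‖u‖) ∂m) * ν univ := by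
    rw [← lintegral_const]
    refine lintegral_congr_ae ?_
    have h0 : ∀ᵐ y ∂ν, y ≠ 0 := by
      rw [hν]
      exact ae_restrict_of_ae (Measure.ae_ne volume 0)
    filter_upwards [h0] with y hy using hH y hy
  rw [hl, hr] at hswap
  calc ∫⁻ x, f (inner ℝ x u / ‖u‖) ∂m
      = (ν univ)⁻¹ * ((∫⁻ x, f (inner ℝ x u / ‖u‖) ∂m) * ν univ) := by
        rw [mul_comm _ (ν univ), ← mul_assoc, ENNReal.inv_mul_cancel hν0 hνt, one_mul]
    _ = _ := by rw [← hswap]; ring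

lemma interval_dist (rE rmin : ℝ) (hrE : 0 < rE) (hrmin : 0 < rmin) (f : ℝ → ℝ≥0∞) :
    ∫⁻ s in Ioo (-(rE + rmin)) (rE + rmin), f (Real.sqrt ((rE + rmin) ^ 2 + rE ^ 2 - 2 * rE * s)) =
      ∫⁻ r in Ioo rmin (2 * rE + rmin), ENNReal.ofReal (r / rE) * f r := by
  have himg : (fun r : ℝ => ((rE + rmin) ^ 2 + rE ^ 2 - r ^ 2) / (2 * rE)) ''
      Ioo rmin (2 * rE + rmin) = Ioo (-(rE + rmin)) (rE + rmin) := by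
    ext s
    constructor
    · rintro ⟨r, ⟨h1, h2⟩, rfl⟩
      constructor
      · simp only
        rw [lt_div_iff₀ (by positivity)]; nlinarith
      · simp only
        rw [div_lt_iff₀ (by positivity)]; nlinarith
    · rintro ⟨h1, h2⟩
      have hp : rmin ^ 2 < (rE + rmin) ^ 2 + rE ^ 2 - 2 * rE * s := by nlinarith
      refine ⟨Real.sqrt ((rE + rmin) ^ 2 + rE ^ 2 - 2 * rE * s), ⟨?_, ?_⟩, ?_⟩
      · exact Real.lt_sqrt_of_sq_lt hp
      · rw [Real.sqrt_lt' (by positivity)]; nlinarith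
      · simp only
        rw [Real.sq_sqrt (by nlinarith)]
        field_simp
        ring
  rw [← himg, lintegral_image_eq_lintegral_abs_deriv_mul (f' := fun r => -(r / rE))
    measurableSet_Ioo]
  · refine setLIntegral_congr_fun measurableSet_Ioo fun r hr => ?_
    have hr0 : 0 < r := hrmin.trans hr.1
    rw [abs_neg, abs_of_pos (by positivity)]
    congr 2
    rw [show (rE + rmin) ^ 2 + rE ^ 2 -
      2 * rE * (((rE + rmin) ^ 2 + rE ^ 2 - r ^ 2) / (2 * rE)) = r ^ 2 by field_simp; ring,
      Real.sqrt_sq hr0.le]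
  · intro r _
    have := (((hasDerivAt_pow 2 r).const_sub ((rE + rmin) ^ 2 + rE ^ 2)).div_const
      (2 * rE)).hasDerivWithinAt (s := Ioo rmin (2 * rE + rmin))
    have he : -(((2 : ℕ) : ℝ) * r ^ (2 - 1)) / (2 * rE) = -(r / rE) := by
      simp
      field_simp
    rw [he] at this
    exact this
  · intro a ha b hb hab
    have ha' : 0 < a := hrmin.trans ha.1
    have hb' : 0 < b := hrmin.trans hb.1
    simp only at hab
    field_simp at hab
    exact (pow_left_inj₀ ha'.le hb'.le two_ne_zero).1 (by linarith)

/-- **Lemma 1 (PDF part).** The distance from a user on Earth's surface to a satellite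
uniformly distributed on the sphere of radius `r⊕ + rmin` has a density w.r.t. Lebesgue
measure, namely `r / (2 r⊕ (r⊕ + rmin))` on `[rmin, 2 r⊕ + rmin]` and `0` elsewhere. -/
theorem uniform_sphere_distance_pdf
    (rE rmin ρ : ℝ) (hrE : 0 < rE) (hrmin : 0 < rmin) (hρ : ρ = rE + rmin)
    (S : Set (EuclideanSpace ℝ (Fin 3)))
    (hS : S = Metric.sphere (0 : EuclideanSpace ℝ (Fin 3)) ρ)
    (u : EuclideanSpace ℝ (Fin 3)) (hu : ‖u‖ = rE)
    (μ : Measure (EuclideanSpace ℝ (Fin 3)))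
    (hμ : μ = (μH[2] S)⁻¹ •
      ((μH[2] : Measure (EuclideanSpace ℝ (Fin 3))).restrict S)) :
    (μ.map (fun x => ‖x - u‖)) ≪ (volume : Measure ℝ) ∧
    μ.map (fun x => ‖x - u‖) =
      (volume : Measure ℝ).withDensity (fun r =>
        ENNReal.ofReal
          (if rmin ≤ r ∧ r ≤ 2 * rE + rmin then r / (2 * rE * (rE + rmin)) else 0)) := by
  have hρ0 : 0 < ρ := by rw [hρ]; positivity
  have hu0 : u ≠ 0 := by rw [← norm_pos_iff, hu]; exact hrE
  suffices h : μ.map (fun x => ‖x - u‖) =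
      (volume : Measure ℝ).withDensity (fun r =>
        ENNReal.ofReal
          (if rmin ≤ r ∧ r ≤ 2 * rE + rmin then r / (2 * rE * (rE + rmin)) else 0)) by
    refine ⟨?_, h⟩
    rw [h]
    exact withDensity_absolutelyContinuous _ _
  obtain ⟨D, hD⟩ := sphere_height ρ hρ0 u hu0
  have hSt : (μH[2] : Measure (EuclideanSpace ℝ (Fin 3))) S ≠ ⊤ := by
    rw [hS]; exact (sphere_hausdorff_lt_top ρ hρ0).ne
  have hS0 : (μH[2] : Measure (EuclideanSpace ℝ (Fin 3))) S ≠ 0 := by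
    rw [hS]; exact sphere_hausdorff_ne_zero ρ hρ0
  have hSm : MeasurableSet S := by rw [hS]; exact Metric.isClosed_sphere.measurableSet
  -- the total mass identifies the constant
  have hmass : (μH[2] : Measure (EuclideanSpace ℝ (Fin 3))) S = D * ENNReal.ofReal (2 * ρ) := by
    have := hD (fun _ => 1) measurable_const
    simp only [lintegral_one, Measure.restrict_apply_univ, Real.volume_Ioo] at this
    rw [hS, this]
    congr 2
    ring
  have hcD : (μH[2] S)⁻¹ * D = ENNReal.ofReal (1 / (2 * ρ)) := by
    have h2 : ENNReal.ofReal (2 * ρ) ≠ 0 := by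
      rw [Ne, ENNReal.ofReal_eq_zero, not_le]; positivity
    have h3 : (μH[2] S)⁻¹ * D * ENNReal.ofReal (2 * ρ) = 1 := by
      rw [mul_assoc, ← hmass, ENNReal.inv_mul_cancel hS0 hSt]
    rw [one_div, ENNReal.ofReal_inv_of_pos (by positivity)]
    exact ENNReal.eq_inv_of_mul_eq_one_left h3
  have hdm : Measurable (fun r : ℝ => ENNReal.ofReal
      (if rmin ≤ r ∧ r ≤ 2 * rE + rmin then r / (2 * rE * (rE + rmin)) else 0)) := by
    refine ENNReal.measurable_ofReal.comp (Measurable.ite ?_ (by fun_prop) measurable_const)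
    exact measurableSet_Icc
  refine Measure.ext_of_lintegral _ fun f hf => ?_
  rw [lintegral_map hf (by fun_prop), lintegral_withDensity_eq_lintegral_mul _ hdm hf, hμ,
    lintegral_smul_measure, smul_eq_mul]
  have h1 : ∫⁻ x in S, f ‖x - u‖ ∂μH[2] =
      ∫⁻ x in S, f (Real.sqrt ((rE + rmin) ^ 2 + rE ^ 2 - 2 * rE * (inner ℝ x u / ‖u‖))) ∂μH[2] := by
    refine setLIntegral_congr_fun hSm fun x hx => ?_
    rw [hS, mem_sphere_zero_iff_norm] at hx
    congr 1
    symm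
    rw [Real.sqrt_eq_iff_mul_self_eq (by
      rw [hu, show 2 * rE * (inner ℝ x u / rE) = 2 * inner ℝ x u by field_simp, ← hρ, ← hx, ← hu]
      nlinarith [real_inner_le_norm x u, sq_nonneg (‖x‖ - ‖u‖)]) (norm_nonneg _)]
    rw [hu, show 2 * rE * (inner ℝ x u / rE) = 2 * inner ℝ x u by field_simp, ← hρ, ← hx, ← hu,
      ← sq, norm_sub_sq_real]
    ring
  rw [h1, hS, hD (fun s => f (Real.sqrt ((rE + rmin) ^ 2 + rE ^ 2 - 2 * rE * s))) (by fun_prop),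
    ← hS, ← mul_assoc, hcD, hρ, interval_dist rE rmin hrE hrmin,
    ← lintegral_const_mul' _ _ ENNReal.ofReal_ne_top,
    setLIntegral_congr Ioo_ae_eq_Icc, ← lintegral_indicator measurableSet_Icc]
  refine lintegral_congr fun r => ?_
  by_cases hr : r ∈ Icc rmin (2 * rE + rmin)
  · rw [indicator_of_mem hr, Pi.mul_apply, if_pos (mem_Icc.1 hr), ← mul_assoc,
      ← ENNReal.ofReal_mul (by positivity)]
    congr 2
    field_simp
  · have hr' : ¬ (rmin ≤ r ∧ r ≤ 2 * rE + rmin) := hr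
    rw [indicator_of_notMem hr, Pi.mul_apply, if_neg hr']
    simp
end

section
/- Let r⊕ > 0 and rmin > 0 be real numbers, let ρ = r⊕ + rmin, let S be the sphere of radius ρ centered at the origin in EuclideanSpace ℝ (Fin 3), let u be a fixed point with ‖u‖ = r⊕, and let μ be the uniform probability measure on S. Then for all real r₀, r with rmin ≤ r₀ < r ≤ 2·r⊕ + rmin, the conditional probability μ{x : ‖x − u‖ ≤ r | ‖x − u‖ > r₀} = μ{x : r₀ < ‖x − u‖ ≤ r} / μ{x : ‖x − u‖ > r₀} equals (r² − r₀²) / ((2·r⊕ + rmin)² − r₀²). -/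
open MeasureTheory

abbrev E3 := EuclideanSpace ℝ (Fin 3)

theorem sphere_meas_lt_top (ρ : ℝ) (hρ : 0 < ρ) :
    (μH[2] : Measure E3) (Metric.sphere (0 : E3) ρ) < ⊤ := by
  let f : (Fin 2 → ℝ) → E3 := fun p =>
    !₂[ρ * (Real.cos (p 0) * Real.cos (p 1)), ρ * (Real.cos (p 0) * Real.sin (p 1)), ρ * Real.sin (p 0)]
  have hf : ContDiff ℝ 1 f := by
    rw [contDiff_euclidean]
    intro i
    fin_cases i <;> simp [f] <;> fun_prop
  have hK : IsCompact (Set.Icc (fun _ => -4 : Fin 2 → ℝ) (fun _ => 4)) := isCompact_Icc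
  obtain ⟨K, hK2⟩ := hf.contDiffOn.exists_lipschitzOnWith (s := Set.Icc (fun _ => -4 : Fin 2 → ℝ) (fun _ => 4)) one_ne_zero
    (convex_Icc _ _) hK
  have h1 := hK2.hausdorffMeasure_image_le (d := 2) (by norm_num)
  have h2 : (μH[2] : Measure (Fin 2 → ℝ)) = volume := by
    have := hausdorffMeasure_pi_real (ι := Fin 2)
    simpa using this
  rw [h2] at h1
  refine lt_of_le_of_lt (measure_mono ?_) (lt_of_le_of_lt h1 ?_)
  · intro x hx
    have hx1 : x 0 ^ 2 + x 1 ^ 2 + x 2 ^ 2 = ρ ^ 2 := by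
      have : ‖x‖ = ρ := by simpa using hx
      rw [← this, EuclideanSpace.norm_sq_eq, Fin.sum_univ_three]
      simp
    have hb1 : -1 ≤ x 2 / ρ := by
      rw [le_div_iff₀ hρ]; nlinarith [sq_nonneg (x 0), sq_nonneg (x 1)]
    have hb2 : x 2 / ρ ≤ 1 := by
      rw [div_le_iff₀ hρ]; nlinarith [sq_nonneg (x 0), sq_nonneg (x 1)]
    let z : ℂ := ⟨x 0, x 1⟩
    have hz : ‖z‖ = ρ * Real.cos (Real.arcsin (x 2 / ρ)) := by
      rw [Real.cos_arcsin, Complex.norm_eq_sqrt_sq_add_sq]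
      simp only [z]
      rw [show x 0 ^ 2 + x 1 ^ 2 = ρ ^ 2 * (1 - (x 2 / ρ) ^ 2) by field_simp; linarith,
        Real.sqrt_mul (by positivity), Real.sqrt_sq hρ.le]
    refine ⟨![Real.arcsin (x 2 / ρ), z.arg], ?_, ?_⟩
    · have := Real.pi_lt_four
      have a1 := Real.neg_pi_div_two_le_arcsin (x 2 / ρ)
      have a2 := Real.arcsin_le_pi_div_two (x 2 / ρ)
      have a3 := Complex.neg_pi_lt_arg z
      have a4 := Complex.arg_le_pi z
      have := Real.pi_pos
      refine ⟨fun i => ?_, fun i => ?_⟩ <;> fin_cases i <;> simp <;> linarith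
    · have c1 := Complex.norm_mul_cos_arg z
      have c2 := Complex.norm_mul_sin_arg z
      rw [hz] at c1 c2
      ext i
      fin_cases i
      · simpa [f, mul_assoc] using c1
      · simpa [f, mul_assoc] using c2
      · simp only [f]
        simp [Real.sin_arcsin hb1 hb2]
        field_simp
  · exact ENNReal.mul_lt_top (by simp) hK.measure_lt_top

theorem sphere_meas_pos (ρ : ℝ) (hρ : 0 < ρ) :
    0 < (μH[2] : Measure E3) (Metric.sphere (0 : E3) ρ) := by
  let f : E3 → (Fin 2 → ℝ) := fun x => ![x 0, x 1]
  have hf : LipschitzWith 1 f := by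
    refine LipschitzWith.of_dist_le_mul fun x y => ?_
    rw [dist_pi_le_iff (by positivity)]
    intro i
    have h : ∀ j : Fin 3, |x j - y j| ≤ dist x y := by
      intro j
      rw [EuclideanSpace.dist_eq]
      apply Real.le_sqrt_of_sq_le
      have := Finset.single_le_sum (f := fun i => dist (x i) (y i) ^ 2) (fun i _ => sq_nonneg _) (Finset.mem_univ j)
      simpa [Real.dist_eq] using this
    fin_cases i
    · simpa [f, Real.dist_eq] using h 0
    · simpa [f, Real.dist_eq] using h 1
  have h1 := (hf.lipschitzOnWith (s := Metric.sphere (0 : E3) ρ)).hausdorffMeasure_image_le (d := 2) (by norm_num)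
  have h2 : (μH[2] : Measure (Fin 2 → ℝ)) = volume := by
    have := hausdorffMeasure_pi_real (ι := Fin 2)
    simpa using this
  rw [h2] at h1
  simp only [ENNReal.coe_one, ENNReal.one_rpow, one_mul] at h1
  refine lt_of_lt_of_le ?_ h1
  refine lt_of_lt_of_le (Metric.measure_ball_pos volume (0 : Fin 2 → ℝ) (half_pos hρ)) (measure_mono ?_)
  intro p hp
  rw [mem_ball_zero_iff, pi_norm_lt_iff (by positivity)] at hp
  have p0 := hp 0
  have p1 := hp 1
  rw [Real.norm_eq_abs, abs_lt] at p0 p1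
  have hn : 0 ≤ ρ ^ 2 - p 0 ^ 2 - p 1 ^ 2 := by nlinarith
  refine ⟨!₂[p 0, p 1, √(ρ ^ 2 - p 0 ^ 2 - p 1 ^ 2)], ?_, ?_⟩
  · rw [mem_sphere_zero_iff_norm, EuclideanSpace.norm_eq, Fin.sum_univ_three]
    simp [Real.sq_sqrt hn]
    rw [Real.sqrt_eq_iff_eq_sq] <;> nlinarith
  · ext i; fin_cases i <;> simp [f]

open scoped RealInnerProductSpace

theorem gauss_pow (k : ℕ) : ∫ z : ℝ, z ^ (2 * k) * Real.exp (-z ^ 2) = Real.Gamma (k + 1 / 2) := by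
  have h := integral_comp_abs (f := fun z => z ^ (2 * k) * Real.exp (-z ^ 2))
  simp only [sq_abs, pow_mul] at h ⊢
  rw [h]
  have h2 := integral_rpow_mul_exp_neg_rpow (p := 2) (q := 2 * k) (by norm_num)
    (by have : (0:ℝ) ≤ k := by positivity
        linarith)
  rw [show ((2 * k + 1 : ℝ) / 2) = k + 1 / 2 by ring] at h2
  have : ∀ z : ℝ, z ^ (2 * k : ℝ) * Real.exp (-z ^ (2 : ℝ)) = (z ^ 2) ^ k * Real.exp (-z ^ 2) := by
    intro z
    rw [show (2 * k : ℝ) = ((2 * k : ℕ) : ℝ) by push_cast; ring, Real.rpow_natCast, pow_mul,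
      Real.rpow_two]
  simp only [this] at h2
  rw [h2]; ring

theorem gauss_e0 (k : ℕ) : ∫ g : E3, (g 0) ^ (2 * k) * Real.exp (-‖g‖ ^ 2) =
    Real.Gamma (k + 1 / 2) * Real.Gamma (1 / 2) ^ 2 := by
  rw [← (PiLp.volume_preserving_toLp (Fin 3)).integral_comp
    (MeasurableEquiv.toLp 2 (Fin 3 → ℝ)).measurableEmbedding]
  have h := integral_fintype_prod_volume_eq_prod (𝕜 := ℝ) (ι := Fin 3) (E := fun _ => ℝ)
    (fun i z => if i = 0 then z ^ (2 * k) * Real.exp (-z ^ 2) else z ^ (2 * 0) * Real.exp (-z ^ 2))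
  simp only [Fin.prod_univ_three] at h
  simp only [if_true, show (1 : Fin 3) ≠ 0 by decide, show (2 : Fin 3) ≠ 0 by decide, if_false, gauss_pow] at h
  simp only [EuclideanSpace.norm_sq_eq, Fin.sum_univ_three, Real.norm_eq_abs, sq_abs]
  calc _ = _ := by
        congr 1
        ext x
        rw [neg_add, neg_add, Real.exp_add, Real.exp_add]
        ring
    _ = _ := h
    _ = _ := by simp; ring

theorem exists_isom (v w : E3) (h : ‖v‖ = ‖w‖) : ∃ T : E3 ≃ₗᵢ[ℝ] E3, T v = w :=
  ⟨_, Submodule.reflection_sub h⟩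

theorem gauss_dir (x : E3) (k : ℕ) : ∫ g : E3, ⟪x, g⟫ ^ (2 * k) * Real.exp (-‖g‖ ^ 2) =
    ‖x‖ ^ (2 * k) * (Real.Gamma (k + 1 / 2) * Real.Gamma (1 / 2) ^ 2) := by
  obtain ⟨T, hT⟩ := exists_isom (‖x‖ • EuclideanSpace.single 0 (1 : ℝ)) x (by simp [norm_smul])
  rw [← (T.measurePreserving).integral_comp T.toHomeomorph.measurableEmbedding, ← gauss_e0,
    ← integral_const_mul]
  congr 1
  ext g
  nth_rewrite 1 [← hT]
  rw [T.inner_map_map, T.norm_map, real_inner_smul_left, EuclideanSpace.inner_single_left]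
  simp [mul_pow, mul_assoc]

theorem gauss_norm_int (k : ℕ) : Integrable (fun g : E3 => ‖g‖ ^ (2 * k) * Real.exp (-‖g‖ ^ 2)) := by
  rw [integrable_fun_norm_addHaar volume (f := fun r => r ^ (2 * k) * Real.exp (-r ^ 2))]
  have h2 := integrableOn_rpow_mul_exp_neg_rpow (p := 2) (s := (2 * k + 2 : ℕ)) 
    (by push_cast
        have : (0:ℝ) ≤ k := by positivity
        linarith) (by norm_num)
  simp only [Real.rpow_natCast, Real.rpow_two] at h2
  convert h2 using 2 with y
  simp
  ring

theorem gauss_norm : ∃ B : ℝ, ∀ k : ℕ, ∫ g : E3, ‖g‖ ^ (2 * k) * Real.exp (-‖g‖ ^ 2) =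
    B * Real.Gamma (k + 1 / 2 + 1) := by
  refine ⟨3 * volume.real (Metric.ball (0 : E3) 1) * (1 / 2), fun k => ?_⟩
  rw [integral_fun_norm_addHaar volume (f := fun r => r ^ (2 * k) * Real.exp (-r ^ 2))]
  have h2 := integral_rpow_mul_exp_neg_rpow (p := 2) (q := (2 * k + 2 : ℕ)) (by norm_num)
    (by push_cast
        have : (0:ℝ) ≤ k := by positivity
        linarith) 
  simp only [Real.rpow_natCast, Real.rpow_two] at h2
  rw [show ((((2 * k + 2 : ℕ) : ℝ) + 1) / 2) = k + 1 / 2 + 1 by push_cast; ring] at h2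
  have : ∀ y : ℝ, y ^ (Module.finrank ℝ E3 - 1) • (y ^ (2 * k) * Real.exp (-y ^ 2)) = 
    y ^ (2 * k + 2) * Real.exp (-y ^ 2) := by
    intro y; simp; ring
  simp only [this, h2]
  simp
  ring

theorem even_moment (σ : Measure E3) [IsFiniteMeasure σ] (ρ : ℝ) (hρ : 0 < ρ)
    (hn : ∀ᵐ x ∂σ, ‖x‖ = ρ) (hinv : ∀ T : E3 ≃ₗᵢ[ℝ] E3, MeasurePreserving T σ σ) (u : E3) (k : ℕ) :
    ∫ x, ⟪x, u⟫ ^ (2 * k) ∂σ = σ.real Set.univ * (ρ * ‖u‖) ^ (2 * k) / (2 * k + 1) := by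
  let e : E3 := EuclideanSpace.single 0 1
  have hdir : ∀ v : E3, ∫ x, ⟪x, v⟫ ^ (2 * k) ∂σ = ‖v‖ ^ (2 * k) * ∫ x, ⟪x, e⟫ ^ (2 * k) ∂σ := by
    intro v
    obtain ⟨T, hT⟩ := exists_isom (‖v‖ • e) v (by simp [norm_smul, e])
    rw [← (hinv T).integral_comp T.toHomeomorph.measurableEmbedding, 
      ← integral_const_mul]
    congr 1
    ext g
    nth_rewrite 1 [← hT]
    rw [T.inner_map_map, real_inner_smul_right, mul_pow]
  rw [hdir]
  set M := ∫ x, ⟪x, e⟫ ^ (2 * k) ∂σ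
  have hint : Integrable (Function.uncurry fun (x g : E3) => ⟪x, g⟫ ^ (2 * k) * Real.exp (-‖g‖ ^ 2))
      (σ.prod volume) := by
    have h0 := (integrable_const (μ := σ) (ρ ^ (2 * k) : ℝ)).mul_prod (gauss_norm_int k)
    refine h0.mono' ?_ ?_
    · apply Continuous.aestronglyMeasurable
      unfold Function.uncurry
      fun_prop
    · have : ∀ᵐ z : E3 × E3 ∂(σ.prod volume), ‖z.1‖ = ρ :=
        Measure.quasiMeasurePreserving_fst.ae hn
      filter_upwards [this] with z hz
      simp only [Function.uncurry]
      rw [norm_mul, norm_pow, Real.norm_of_nonneg (Real.exp_pos _).le, ← mul_assoc, ← mul_pow, ← hz]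
      gcongr
      exact norm_inner_le_norm _ _
  have hsw := integral_integral_swap hint
  simp only [gauss_dir] at hsw
  obtain ⟨B, hB⟩ := gauss_norm
  have h1 : ∫ x, ‖x‖ ^ (2 * k) * (Real.Gamma (k + 1 / 2) * Real.Gamma (1 / 2) ^ 2) ∂σ = 
     σ.real Set.univ * (ρ ^ (2 * k) * (Real.Gamma (k + 1 / 2) * Real.Gamma (1 / 2) ^ 2)) := by
    rw [← smul_eq_mul (σ.real _), ← integral_const]
    apply integral_congr_ae
    filter_upwards [hn] with x hx
    rw [hx]
  have h2 : ∫ g : E3, ∫ x, ⟪x, g⟫ ^ (2 * k) * Real.exp (-‖g‖ ^ 2) ∂σ = M * (B * Real.Gamma (k + 1 / 2 + 1)) := by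
    rw [← hB, ← integral_const_mul]
    congr 1
    ext g
    rw [integral_mul_const, hdir]
    ring
  rw [h1, h2] at hsw
  have hB0 : B * Real.Gamma (1 / 2 + 1) = Real.Gamma (1 / 2) * Real.Gamma (1 / 2) ^ 2 := by
    have a := hB 0
    have b := gauss_e0 0
    simp only [mul_zero, pow_zero, Nat.cast_zero, zero_add] at a b
    rw [← a, ← b]
  have hk : (0 : ℝ) < k + 1 / 2 := by positivity
  have g1 := Real.Gamma_pos_of_pos (show (0:ℝ) < 1 / 2 by norm_num)
  have g2 := Real.Gamma_pos_of_pos hk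
  rw [Real.Gamma_add_one (by norm_num)] at hB0
  rw [Real.Gamma_add_one hk.ne'] at hsw
  have hB1 : B = 2 * Real.Gamma (1 / 2) ^ 2 := by
    apply mul_right_cancel₀ g1.ne'
    linarith
  rw [hB1] at hsw
  have : σ.real Set.univ * ρ ^ (2 * k) = M * (2 * k + 1) := by
    apply mul_right_cancel₀ (mul_pos g2 (pow_pos g1 2)).ne'
    linarith
  rw [eq_div_iff (by positivity), mul_pow]
  linear_combination (-‖u‖ ^ (2 * k)) * this

theorem odd_moment (σ : Measure E3) 
    (hinv : ∀ T : E3 ≃ₗᵢ[ℝ] E3, MeasurePreserving T σ σ) (u : E3) (k : ℕ) :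
    ∫ x, ⟪x, u⟫ ^ (2 * k + 1) ∂σ = 0 := by
  have h := (hinv (LinearIsometryEquiv.neg ℝ)).integral_comp
    (LinearIsometryEquiv.neg ℝ : E3 ≃ₗᵢ[ℝ] E3).toHomeomorph.measurableEmbedding (fun x => ⟪x, u⟫ ^ (2 * k + 1))
  simp only [LinearIsometryEquiv.coe_neg, inner_neg_left, (show Odd (2 * k + 1) from ⟨k, rfl⟩).neg_pow, integral_neg] at h
  linarith

theorem ext_moments (μ ν : Measure ℝ) [IsFiniteMeasure μ] [IsFiniteMeasure ν] (a : ℝ)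
    (hμ : ∀ᵐ x ∂μ, x ∈ Set.Icc (-a) a) (hν : ∀ᵐ x ∂ν, x ∈ Set.Icc (-a) a)
    (h : ∀ n : ℕ, ∫ x, x ^ n ∂μ = ∫ x, x ^ n ∂ν) : μ = ν := by
  have hint : ∀ (τ : Measure ℝ) [IsFiniteMeasure τ], (∀ᵐ x ∂τ, x ∈ Set.Icc (-a) a) →
      ∀ f : ℝ → ℝ, Continuous f → Integrable f τ := by
    intro τ _ hτ f hf
    have := hf.continuousOn.integrableOn_compact (μ := τ) (isCompact_Icc (a := -a) (b := a))
    rwa [IntegrableOn, Measure.restrict_eq_self_of_ae_mem hτ] at this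
  have hpoly : ∀ p : Polynomial ℝ, ∫ x, p.eval x ∂μ = ∫ x, p.eval x ∂ν := by
    intro p
    simp only [Polynomial.eval_eq_sum_range]
    rw [integral_finsetSum _ (fun i _ => hint μ hμ _ (by fun_prop)),
      integral_finsetSum _ (fun i _ => hint ν hν _ (by fun_prop))]
    simp only [integral_const_mul, h]
  have key : ∀ (τ : Measure ℝ) [IsFiniteMeasure τ], (∀ᵐ x ∂τ, x ∈ Set.Icc (-a) a) →
      ∀ (f : ℝ → ℝ) (p : Polynomial ℝ) (ε : ℝ), Continuous f → 
        (∀ x ∈ Set.Icc (-a) a, |p.eval x - f x| < ε) → 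
        |∫ x, p.eval x ∂τ - ∫ x, f x ∂τ| ≤ ε * τ.real Set.univ := by
    intro τ _ hτ f p ε hf hp
    rw [← integral_sub (hint τ hτ _ p.continuous) (hint τ hτ _ hf), ← Real.norm_eq_abs]
    apply norm_integral_le_of_norm_le_const
    filter_upwards [hτ] with x hx using (hp x hx).le
  apply ext_of_forall_integral_eq_of_IsFiniteMeasure
  intro f
  apply eq_of_forall_dist_le
  intro ε hε
  set C := μ.real Set.univ + ν.real Set.univ + 1
  have hC : 0 < C := by positivity
  obtain ⟨p, hp⟩ := exists_polynomial_near_of_continuousOn (-a) a f f.continuous.continuousOn (ε / C) (by positivity)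
  have k1 := key μ hμ f p _ f.continuous hp
  have k2 := key ν hν f p _ f.continuous hp
  rw [hpoly] at k1
  have : ε / C * C = ε := by field_simp
  have h3 : 0 < ε / C := by positivity
  rw [Real.dist_eq]
  rw [abs_le] at k1 k2 ⊢
  simp only [C] at this h3 k1 k2
  constructor <;> nlinarith

theorem marginal (σ : Measure E3) [IsFiniteMeasure σ] (ρ : ℝ) (hρ : 0 < ρ)
    (hn : ∀ᵐ x ∂σ, ‖x‖ = ρ) (hinv : ∀ T : E3 ≃ₗᵢ[ℝ] E3, MeasurePreserving T σ σ) (u : E3)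
    (hu : 0 < ‖u‖) :
    σ.map (fun x => ⟪x, u⟫) = ENNReal.ofReal (σ.real Set.univ / (2 * (ρ * ‖u‖))) •
      volume.restrict (Set.Icc (-(ρ * ‖u‖)) (ρ * ‖u‖)) := by
  have hm : Measurable (fun x : E3 => ⟪x, u⟫) := by fun_prop
  set a := ρ * ‖u‖ with ha
  have ha0 : 0 < a := by positivity
  have : IsFiniteMeasure (ENNReal.ofReal (σ.real Set.univ / (2 * a)) • (volume : Measure ℝ).restrict (Set.Icc (-a) a)) :=
    Measure.smul_finite _ (by simp)
  refine ext_moments _ _ a ?_ ?_ ?_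
  · refine (ae_map_iff hm.aemeasurable (p := fun y => y ∈ Set.Icc (-a) a) measurableSet_Icc).2 ?_
    filter_upwards [hn] with x hx
    rw [← hx] at ha
    have := abs_real_inner_le_norm x u
    rw [← ha] at this
    exact abs_le.1 this
  · exact Measure.ae_smul_measure (ae_restrict_mem measurableSet_Icc) _
  · intro n
    rw [integral_map hm.aemeasurable (by fun_prop), integral_smul_measure,
      integral_Icc_eq_integral_Ioc, ← intervalIntegral.integral_of_le (by linarith), integral_pow,
      ENNReal.toReal_ofReal (by positivity)]
    rcases Nat.even_or_odd' n with ⟨k, rfl | rfl⟩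
    · rw [even_moment σ ρ hρ hn hinv]
      rw [(show Odd (2 * k + 1) from ⟨k, rfl⟩).neg_pow, ← ha]
      push_cast
      simp
      field_simp
      ring
    · rw [odd_moment σ hinv]
      rw [(show Even (2 * k + 1 + 1) from ⟨k + 1, by ring⟩).neg_pow]
      simp

theorem conditional_distance_cdf
    (rE rmin ρ : ℝ) (hrE : 0 < rE) (hrmin : 0 < rmin) (hρ : ρ = rE + rmin)
    (S : Set (EuclideanSpace ℝ (Fin 3)))
    (hS : S = Metric.sphere (0 : EuclideanSpace ℝ (Fin 3)) ρ)
    (u : EuclideanSpace ℝ (Fin 3)) (hu : ‖u‖ = rE)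
    (μ : Measure (EuclideanSpace ℝ (Fin 3)))
    (hμ : μ = (μH[2] S)⁻¹ •
      ((μH[2] : Measure (EuclideanSpace ℝ (Fin 3))).restrict S)) :
    ∀ r₀ r : ℝ, rmin ≤ r₀ → r₀ < r → r ≤ 2 * rE + rmin →
      μ {x | r₀ < ‖x - u‖ ∧ ‖x - u‖ ≤ r} / μ {x | r₀ < ‖x - u‖} =
        ENNReal.ofReal ((r ^ 2 - r₀ ^ 2) / ((2 * rE + rmin) ^ 2 - r₀ ^ 2)) := by
  intro r₀ r h0 h1 h2
  have hρ0 : 0 < ρ := by linarith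
  have hfin := sphere_meas_lt_top ρ hρ0
  have hpos := sphere_meas_pos ρ hρ0
  rw [← hS] at hfin hpos
  have hSm : MeasurableSet S := by rw [hS]; exact Metric.isClosed_sphere.measurableSet
  set σ := (μH[2] : Measure (EuclideanSpace ℝ (Fin 3))).restrict S with hσ
  have : IsFiniteMeasure σ := ⟨by simpa [hσ] using hfin⟩
  have hn : ∀ᵐ x ∂σ, ‖x‖ = ρ := by
    filter_upwards [ae_restrict_mem hSm] with x hx
    simpa [hS] using hx
  have hinv : ∀ T : E3 ≃ₗᵢ[ℝ] E3, MeasurePreserving T σ σ := by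
    intro T
    have := (T.toIsometryEquiv.measurePreserving_hausdorffMeasure 2).restrict_preimage_emb
      T.toHomeomorph.measurableEmbedding S
    have hp : (T.toIsometryEquiv : E3 → E3) ⁻¹' S = S := by
      ext x; simp [hS]
    rw [hp] at this
    exact this
  have hmarg := marginal σ ρ hρ0 hn hinv u (by rw [hu]; exact hrE)
  have hm : Measurable (fun x : E3 => ⟪x, u⟫) := by fun_prop
  rw [hu] at hmarg
  set c := σ.real Set.univ / (2 * (ρ * rE)) with hc
  have hc0 : 0 < c := by
    apply div_pos _ (by positivity)
    rw [measureReal_def]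
    apply ENNReal.toReal_pos
    · simpa [hσ] using hpos.ne'
    · exact measure_ne_top _ _
  -- measure of a zone
  have zone : ∀ s, r₀ < s → s ≤ 2 * rE + rmin →
      σ {x | r₀ < ‖x - u‖ ∧ ‖x - u‖ ≤ s} = ENNReal.ofReal (c * ((s ^ 2 - r₀ ^ 2) / 2)) := by
    intro s hs1 hs2
    have e1 : σ {x | r₀ < ‖x - u‖ ∧ ‖x - u‖ ≤ s} =
        σ ((fun x : E3 => ⟪x, u⟫) ⁻¹' (Set.Ico ((ρ ^ 2 + rE ^ 2 - s ^ 2) / 2) ((ρ ^ 2 + rE ^ 2 - r₀ ^ 2) / 2))) := by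
      apply measure_congr
      filter_upwards [hn] with x hx
      have hsq := norm_sub_sq_real x u
      rw [hx, hu] at hsq
      have p1 := norm_nonneg (x - u)
      apply propext
      show (r₀ < ‖x - u‖ ∧ ‖x - u‖ ≤ s) ↔ (_ ≤ ⟪x, u⟫ ∧ ⟪x, u⟫ < _)
      rw [← sq_lt_sq₀ (by linarith) p1, ← sq_le_sq₀ p1 (by linarith), hsq]
      constructor <;> rintro ⟨_, _⟩ <;> constructor <;> linarith
    rw [e1, ← Measure.map_apply hm measurableSet_Ico, hmarg, Measure.smul_apply,
      Measure.restrict_apply measurableSet_Ico, Set.inter_eq_left.2, Real.volume_Ico, smul_eq_mul,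
      ← ENNReal.ofReal_mul hc0.le]
    · congr 1; ring
    · refine Set.Ico_subset_Icc_self.trans (Set.Icc_subset_Icc ?_ ?_) <;> subst hρ <;> nlinarith
  have e2 : σ {x | r₀ < ‖x - u‖} = σ {x | r₀ < ‖x - u‖ ∧ ‖x - u‖ ≤ 2 * rE + rmin} := by
    apply measure_congr
    filter_upwards [hn] with x hx
    apply propext
    show (r₀ < ‖x - u‖) ↔ (r₀ < ‖x - u‖ ∧ ‖x - u‖ ≤ 2 * rE + rmin)
    have := norm_sub_le x u
    rw [hx, hu] at this
    exact ⟨fun h => ⟨h, by linarith⟩, fun h => h.1⟩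
  have hd : 0 < (2 * rE + rmin) ^ 2 - r₀ ^ 2 := by nlinarith
  rw [hμ, Measure.smul_apply, Measure.smul_apply, smul_eq_mul, smul_eq_mul, 
    ENNReal.mul_div_mul_left _ _ (ENNReal.inv_ne_zero.2 hfin.ne) (ENNReal.inv_ne_top.2 hpos.ne'),
    e2, zone r h1 h2, zone _ (by linarith) le_rfl, ← ENNReal.ofReal_div_of_pos (by positivity)]
  congr 1
  field_simp
end
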